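/- arXiv:1206.4179 — 3 statements merged into one kernel-verified Lean document; each statement's English description precedes it below -/
import Mathlib

section
/- Let A be a commutative ring and I an A-module. The functor Mod_A → Set sending M to I ⊗_A M is finitely generated if and only if I is a finitely generated A-module. -/
open CategoryTheory CategoryTheory.Limits CategoryTheory.MonoidalCategory

universe u

variable {A : Type u} [CommRing A]

/-- A functor `Q : Mod_A ⥤ Set` is *finitely generated* if there are an `A`-module `I₀`
and an element `η ∈ Q(I₀)` such that for every `A`-module `M` the map
`Hom_A(I₀, M) → Q(M)`, `f ↦ Q(f)(η)`, is surjective. -/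
def CategoryTheory.Functor.IsFinitelyGenerated (Q : ModuleCat.{u} A ⥤ Type u) : Prop :=
  ∃ (I₀ : ModuleCat.{u} A) (η : Q.obj I₀),
    ∀ (M : ModuleCat.{u} A) (x : Q.obj M), ∃ f : I₀ ⟶ M, Q.map f η = x

open TensorProduct in
lemma aux_forward (A : Type u) [CommRing A] (I : Type u) [AddCommGroup I] [Module A I]
    (N : Type u) [AddCommGroup N] [Module A N] (η : I ⊗[A] N) :
    ∃ S : Finset I, ∀ f : N →ₗ[A] A,
      TensorProduct.rid A I (LinearMap.lTensor I f η) ∈ Submodule.span A (S : Set I) := by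
  classical
  induction η using TensorProduct.induction_on with
  | zero => exact ⟨∅, fun f => by simp⟩
  | tmul i n =>
    refine ⟨{i}, fun f => ?_⟩
    rw [LinearMap.lTensor_tmul, TensorProduct.rid_tmul]
    exact Submodule.smul_mem _ _ (Submodule.subset_span (by simp))
  | add x y hx hy =>
    obtain ⟨S, hS⟩ := hx
    obtain ⟨T, hT⟩ := hy
    refine ⟨S ∪ T, fun f => ?_⟩
    rw [map_add, map_add]
    exact Submodule.add_mem _
      (Submodule.span_mono (by simp) (hS f)) (Submodule.span_mono (by simp) (hT f))

open TensorProduct in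
lemma aux_backward (A : Type u) [CommRing A] (I : Type u) [AddCommGroup I] [Module A I]
    (n : ℕ) (g : Fin n → I) (hg : Submodule.span A (Set.range g) = ⊤)
    (M : Type u) [AddCommGroup M] [Module A M] (x : I ⊗[A] M) :
    ∃ f : (Fin n → A) →ₗ[A] M,
      LinearMap.lTensor I f (∑ j, g j ⊗ₜ[A] (Pi.single j 1 : Fin n → A)) = x := by
  classical
  suffices h : ∃ v : Fin n → M, ∑ j, g j ⊗ₜ[A] v j = x by
    obtain ⟨v, hv⟩ := h
    refine ⟨(Pi.basisFun A (Fin n)).constr A v, ?_⟩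
    rw [map_sum, ← hv]
    refine Finset.sum_congr rfl fun j _ => ?_
    rw [LinearMap.lTensor_tmul, ← Pi.basisFun_apply, Module.Basis.constr_basis]
  induction x using TensorProduct.induction_on with
  | zero => exact ⟨0, by simp⟩
  | tmul i m =>
    have hi : i ∈ Submodule.span A (Set.range g) := by rw [hg]; trivial
    obtain ⟨c, hc⟩ := (Submodule.mem_span_range_iff_exists_fun A).1 hi
    refine ⟨fun j => c j • m, ?_⟩
    rw [← hc, TensorProduct.sum_tmul]
    simp [TensorProduct.smul_tmul]
  | add x y hx hy =>
    obtain ⟨v, hv⟩ := hx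
    obtain ⟨w, hw⟩ := hy
    exact ⟨v + w, by simp [TensorProduct.tmul_add, Finset.sum_add_distrib, hv, hw]⟩

/-- The functor `M ↦ I ⊗[A] M` (as a functor to `Set`) is finitely generated if and only
if `I` is a finitely generated `A`-module. -/
theorem stmt1 (A : Type u) [CommRing A] (I : Type u) [AddCommGroup I] [Module A I] :
    (tensorLeft (ModuleCat.of A I) ⋙ forget (ModuleCat A)).IsFinitelyGenerated ↔
      Module.Finite A I := by
  constructor
  · rintro ⟨N, η, h⟩
    obtain ⟨S, hS⟩ := aux_forward A I N η
    refine ⟨⟨S, ?_⟩⟩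
    rw [eq_top_iff]
    intro i _
    obtain ⟨f, hf⟩ := h (ModuleCat.of A A) (TensorProduct.tmul A i (1 : A))
    have h1 : LinearMap.lTensor I f.hom η = TensorProduct.tmul A i (1 : A) := hf
    have h2 := hS f.hom
    rw [h1, TensorProduct.rid_tmul, one_smul] at h2
    exact h2
  · intro h
    obtain ⟨n, g, hg⟩ := Module.Finite.exists_fin (R := A) (M := I)
    refine ⟨ModuleCat.of A (Fin n → A),
      (∑ j, TensorProduct.tmul A (g j) (Pi.single j 1 : Fin n → A) :
        TensorProduct A I (Fin n → A)), fun M x => ?_⟩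
    obtain ⟨f, hf⟩ := aux_backward A I n g hg M x
    exact ⟨ModuleCat.ofHom f, hf⟩
end

section
/- Let R be a commutative noetherian ring and G : Mod_R → Mod_R an R-linear functor which is bounded and preserves filtered colimits. Then for every prime ideal p of R, the restriction G_{R_p} is bounded: for every finitely generated R_p-module N (regarded as an R-module), G(N) is a finitely generated R_p-module. -/
open CategoryTheory CategoryTheory.Limits

universe u

/-- Every element of `G N` comes from `G M` for a finitely generated submodule `M` of `N`. -/
lemma exists_fg_of_mem (R : Type u) [CommRing R]
    (G : ModuleCat.{u} R ⥤ ModuleCat.{u} R) [PreservesFilteredColimits G]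
    (N : Type u) [AddCommGroup N] [Module R N] (x : G.obj (ModuleCat.of R N)) :
    ∃ (M : Submodule R N) (_ : M.FG) (y : G.obj (ModuleCat.of R M)),
      (G.map (ModuleCat.ofHom M.subtype)).hom y = x := by
  classical
  let F := ModuleCat.directLimitDiagram _ (Module.fgSystem R N)
  let hc := ModuleCat.directLimitIsColimit _ (Module.fgSystem R N)
  have hdir : IsDirectedOrder {M : Submodule R N // M.FG} := inferInstance
  have hne : Nonempty {M : Submodule R N // M.FG} := ⟨⟨⊥, Submodule.fg_bot⟩⟩
  have hfil : IsFiltered {M : Submodule R N // M.FG} := inferInstance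
  let hc' := isColimitOfPreserves (G ⋙ forget (ModuleCat.{u} R)) hc
  let e := (Module.fgSystem.equiv R N).toModuleIso
  obtain ⟨M, y, hy⟩ := Types.jointly_surjective_of_isColimit hc' ((G.map e.inv).hom x)
  change G.obj (ModuleCat.of R M.1) at y
  refine ⟨M.1, M.2, y, ?_⟩
  have h1 : ModuleCat.ofHom M.1.subtype =
      ModuleCat.ofHom (Module.DirectLimit.of R _ _ (Module.fgSystem R N) M) ≫ e.hom := by
    rw [← Module.fgSystem.equiv_comp_of]
    rfl
  rw [h1, G.map_comp]
  have hy' : (G.map (ModuleCat.ofHom (Module.DirectLimit.of R _ _ (Module.fgSystem R N) M))).hom y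
    = (G.map e.inv).hom x := hy
  have h2 : (G.map e.hom).hom ((G.map e.inv).hom x) = x := by
    change (G.map e.inv ≫ G.map e.hom).hom x = x
    rw [← G.map_comp, e.inv_hom_id, G.map_id]
    rfl
  exact (congrArg (G.map e.hom).hom hy').trans h2

/-- The action of `A` on `G N` by functoriality. -/
def actHom (R : Type u) [CommRing R] (A : Type u) [CommRing A] [Algebra R A]
    (G : ModuleCat.{u} R ⥤ ModuleCat.{u} R) [G.Additive]
    (N : Type u) [AddCommGroup N] [Module R N] [Module A N] [IsScalarTower R A N] :
    A →+* Module.End R (G.obj (ModuleCat.of R N)) where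
  toFun a := (G.map (ModuleCat.ofHom (Module.toModuleEnd R (S := A) N a))).hom
  map_one' := by
    rw [map_one]
    exact congrArg ModuleCat.Hom.hom (G.map_id _)
  map_mul' a b := by
    rw [map_mul]
    exact congrArg ModuleCat.Hom.hom (G.map_comp
      (ModuleCat.ofHom (Module.toModuleEnd R (S := A) N b))
      (ModuleCat.ofHom (Module.toModuleEnd R (S := A) N a)))
  map_zero' := by
    rw [map_zero]
    exact congrArg ModuleCat.Hom.hom (G.map_zero _ _)
  map_add' a b := by
    rw [map_add]
    exact congrArg ModuleCat.Hom.hom (G.map_add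
      (f := ModuleCat.ofHom (Module.toModuleEnd R (S := A) N a))
      (g := ModuleCat.ofHom (Module.toModuleEnd R (S := A) N b)))

lemma actHom_algebraMap (R : Type u) [CommRing R] (A : Type u) [CommRing A] [Algebra R A]
    (G : ModuleCat.{u} R ⥤ ModuleCat.{u} R) [G.Additive] [G.Linear R]
    (N : Type u) [AddCommGroup N] [Module R N] [Module A N] [IsScalarTower R A N] (r : R)
    (x : G.obj (ModuleCat.of R N)) :
    actHom R A G N (algebraMap R A r) x = r • x := by
  have h : ModuleCat.ofHom (Module.toModuleEnd R (S := A) N (algebraMap R A r)) =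
      r • 𝟙 (ModuleCat.of R N) := by
    ext n
    exact algebraMap_smul A r n
  change (G.map (ModuleCat.ofHom (Module.toModuleEnd R (S := A) N (algebraMap R A r)))).hom x = _
  rw [h, G.map_smul, G.map_id]
  rfl

/-- Some denominator `s` moves a finitely generated `R`-submodule into a given `R`-submodule
that generates `N` over the localization. -/
lemma exists_smul_le (R : Type u) [CommRing R] (S : Submonoid R) (A : Type u) [CommRing A]
    [Algebra R A] [IsLocalization S A]
    (N : Type u) [AddCommGroup N] [Module R N] [Module A N] [IsScalarTower R A N]
    (M M' : Submodule R N) (hM : Submodule.span A (M : Set N) = ⊤) (hM' : M'.FG) :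
    ∃ s : S, ∀ m ∈ M', (s : R) • m ∈ M := by
  have key : ∀ n : N, ∃ s : S, (s : R) • n ∈ M := by
    intro n
    have hn : n ∈ Submodule.span A (M : Set N) := hM ▸ Submodule.mem_top
    induction hn using Submodule.span_induction with
    | mem x hx => exact ⟨1, by simpa using hx⟩
    | zero => exact ⟨1, by simp⟩
    | add x y _ _ hx hy =>
      obtain ⟨s, hs⟩ := hx
      obtain ⟨t, ht⟩ := hy
      refine ⟨s * t, ?_⟩
      rw [smul_add]
      refine M.add_mem ?_ ?_
      · rw [Submonoid.coe_mul, mul_comm, mul_smul]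
        exact M.smul_mem _ hs
      · rw [Submonoid.coe_mul, mul_smul]
        exact M.smul_mem _ ht
    | smul a x _ hx =>
      obtain ⟨s, hs⟩ := hx
      obtain ⟨⟨r, t⟩, hrt⟩ := IsLocalization.surj S a
      refine ⟨s * t, ?_⟩
      have : ((s * t : S) : R) • a • x = r • (s : R) • x := by
        rw [← algebraMap_smul A ((s * t : S) : R), ← algebraMap_smul A r,
          ← algebraMap_smul A (s : R), smul_smul, smul_smul, Submonoid.coe_mul, map_mul,
          ← hrt]
        congr 1
        ring
      rw [this]
      exact M.smul_mem _ hs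
  induction M', hM' using Submodule.fg_induction with
  | singleton x =>
    obtain ⟨s, hs⟩ := key x
    refine ⟨s, fun m hm => ?_⟩
    obtain ⟨r, rfl⟩ := Submodule.mem_span_singleton.1 hm
    rw [smul_comm]
    exact M.smul_mem _ hs
  | sup M₁ M₂ _ _ h₁ h₂ =>
    obtain ⟨s, hs⟩ := h₁
    obtain ⟨t, ht⟩ := h₂
    refine ⟨s * t, fun m hm => ?_⟩
    obtain ⟨x, hx, y, hy, rfl⟩ := Submodule.mem_sup.1 hm
    rw [smul_add]
    refine M.add_mem ?_ ?_
    · rw [Submonoid.coe_mul, mul_comm, mul_smul]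
      exact M.smul_mem _ (hs x hx)
    · rw [Submonoid.coe_mul, mul_smul]
      exact M.smul_mem _ (ht y hy)

/-- Let `R` be a commutative noetherian ring and `G : Mod_R → Mod_R` an `R`-linear functor
which is bounded (it sends finitely generated modules to finitely generated modules) and
preserves filtered colimits.  Then for every prime ideal `p` of `R` the restriction
`G_{R_p}` is bounded: for every finitely generated `R_p`-module `N` (regarded as an
`R`-module), `G(N)` carries an `R_p`-module structure compatible with its `R`-module
structure, under which it is a finitely generated `R_p`-module. -/
theorem stmt15 (R : Type u) [CommRing R] [IsNoetherianRing R]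
    (G : ModuleCat.{u} R ⥤ ModuleCat.{u} R) [G.Additive] [G.Linear R]
    [PreservesFilteredColimits G]
    (hbdd : ∀ M : ModuleCat.{u} R, Module.Finite R M → Module.Finite R (G.obj M))
    (p : Ideal R) [p.IsPrime] (N : Type u) [AddCommGroup N]
    [Module R N] [Module (Localization.AtPrime p) N]
    [IsScalarTower R (Localization.AtPrime p) N]
    [Module.Finite (Localization.AtPrime p) N] :
    ∃ _inst : Module (Localization.AtPrime p) (G.obj (ModuleCat.of R N)),
      IsScalarTower R (Localization.AtPrime p) (G.obj (ModuleCat.of R N)) ∧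
        Module.Finite (Localization.AtPrime p) (G.obj (ModuleCat.of R N)) := by
  let A := Localization.AtPrime p
  let inst : Module A (G.obj (ModuleCat.of R N)) := Module.compHom _ (actHom R A G N)
  have hsm : ∀ (a : A) (x : G.obj (ModuleCat.of R N)), a • x = actHom R A G N a x :=
    fun _ _ => rfl
  have htow : IsScalarTower R A (G.obj (ModuleCat.of R N)) := by
    refine ⟨fun r a x => ?_⟩
    rw [hsm, hsm, Algebra.smul_def, map_mul, Module.End.mul_apply, actHom_algebraMap]
  refine ⟨inst, htow, ?_⟩
  obtain ⟨T, hT⟩ := Module.Finite.fg_top (R := A) (M := N)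
  let M : Submodule R N := Submodule.span R (T : Set N)
  have hMfin : Module.Finite R M := Module.Finite.span_finset R T
  have hMtop : Submodule.span A (M : Set N) = ⊤ := by
    rw [eq_top_iff, ← hT]
    exact Submodule.span_mono Submodule.subset_span
  let i : ModuleCat.of R M ⟶ ModuleCat.of R N := ModuleCat.ofHom M.subtype
  have hfin : Module.Finite R (G.obj (ModuleCat.of R M)) := hbdd _ hMfin
  obtain ⟨U, hU⟩ := hfin.fg_top
  classical
  refine ⟨U.image (G.map i).hom, ?_⟩
  rw [eq_top_iff]
  rintro x -
  have himg : ∀ z, (G.map i).hom z ∈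
      Submodule.span A ((U.image (G.map i).hom : Finset _) : Set (G.obj (ModuleCat.of R N))) := by
    intro z
    have hz : z ∈ Submodule.span R (U : Set (G.obj (ModuleCat.of R M))) :=
      hU ▸ Submodule.mem_top
    apply Submodule.span_le_restrictScalars R A
    rw [Finset.coe_image, Submodule.span_image]
    exact Submodule.mem_map_of_mem hz
  obtain ⟨M', hM', y, rfl⟩ := exists_fg_of_mem R G N x
  obtain ⟨s, hs⟩ := exists_smul_le R p.primeCompl A N M M' hMtop hM'
  let g : ModuleCat.of R M' ⟶ ModuleCat.of R M :=
    ModuleCat.ofHom (((s : R) • M'.subtype).codRestrict M (fun m => hs m m.2))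
  let a : A := IsLocalization.mk' A 1 s
  have hcomp : ModuleCat.ofHom M'.subtype =
      g ≫ i ≫ ModuleCat.ofHom (Module.toModuleEnd R (S := A) N a) := by
    ext m
    change (m : N) = a • (s : R) • (m : N)
    rw [← algebraMap_smul A (s : R), smul_smul, IsLocalization.mk'_spec, map_one, one_smul]
  have hfinal : (G.map (ModuleCat.ofHom M'.subtype)).hom y =
      a • (G.map i).hom ((G.map g).hom y) := by
    rw [hcomp, G.map_comp, G.map_comp]
    rfl
  rw [hfinal]
  exact Submodule.smul_mem _ _ (himg _)
end

section
/- Let R be a commutative noetherian ring and G : Mod_R → Mod_R an R-linear functor which is bounded, half-exact, and preserves filtered colimits. Then V(G) = { q ∈ Spec R : G(κ(q)) = 0 }, where κ(q) is the residue field of R at q regarded as an R-module. That is, for a prime q of R, G(κ(q)) = 0 if and only if G(N) = 0 for every R-module N admitting an R_q-module structure. -/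
open CategoryTheory CategoryTheory.Limits

universe u

variable {R : Type u} [CommRing R]

/-- The residue field `κ(q) = R_q/qR_q` at a prime ideal `q`, as an `R`-module. -/
noncomputable abbrev residueFieldAt (q : Ideal R) [q.IsPrime] : ModuleCat.{u} R :=
  ModuleCat.of R (IsLocalRing.ResidueField (Localization.AtPrime q))

/-- A finitely generated (or arbitrary) module `M` is killed locally at `q` by `G`. -/
def LocKill {R : Type u} [CommRing R] (G : ModuleCat.{u} R ⥤ ModuleCat.{u} R) (q : Ideal R)
    (M : ModuleCat.{u} R) : Prop :=
  ∀ y : G.obj M, ∃ s, s ∉ q ∧ s • y = 0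

lemma map_smul_id_apply {R : Type u} [CommRing R] (G : ModuleCat.{u} R ⥤ ModuleCat.{u} R)
    [G.Additive] [G.Linear R] {M N : ModuleCat.{u} R} (r : R) (f : M ⟶ N) (y : G.obj M) :
    G.map (r • f) y = r • G.map f y := by
  rw [G.map_smul]; rfl

section colim

variable {R : Type u} [CommRing R] (N : ModuleCat.{u} R)

/-- the diagram of finitely generated submodules -/
def fgDiag : {F : Submodule R N // F.FG} ⥤ ModuleCat.{u} R where
  obj F := ModuleCat.of R F.1
  map h := ModuleCat.ofHom (Submodule.inclusion h.le)
  map_id _ := rfl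
  map_comp _ _ := rfl

/-- the cocone of finitely generated submodules -/
def fgCocone : Cocone (fgDiag N) where
  pt := N
  ι := { app := fun F => ModuleCat.ofHom F.1.subtype
         naturality := fun _ _ _ => rfl }

lemma fgCocone_isColimit : Nonempty (IsColimit (fgCocone N)) := by
  classical
  let e : ModuleCat.of R (Module.DirectLimit _ (Module.fgSystem R N)) ≅ N :=
    (Module.fgSystem.equiv R N).toModuleIso
  let D := ModuleCat.directLimitCocone (R := R) (fun F : {F : Submodule R N // F.FG} => F.1)
    (Module.fgSystem R N)
  have hD : IsColimit D := ModuleCat.directLimitIsColimit (R := R) _ _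
  have : IsColimit (fgCocone N) := IsColimit.ofIsoColimit (F := fgDiag N) hD
    (Cocone.ext e (fun F => by
      ext x
      exact congrArg (fun φ => φ x) (Module.fgSystem.equiv_comp_of (R := R) (M := N) F)))
  exact ⟨this⟩

instance : IsFiltered {F : Submodule R N // F.FG} :=
  have : Nonempty {F : Submodule R N // F.FG} := ⟨⟨⊥, Submodule.fg_bot⟩⟩
  inferInstance

variable (G : ModuleCat.{u} R ⥤ ModuleCat.{u} R) [PreservesFilteredColimits G]

lemma exists_fg_rep (x : G.obj N) : ∃ F : Submodule R N, F.FG ∧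
    ∃ y : G.obj (ModuleCat.of R F), G.map (ModuleCat.ofHom F.subtype) y = x := by
  obtain ⟨h⟩ := fgCocone_isColimit N
  obtain ⟨F, y, hy⟩ := Concrete.isColimit_exists_rep (fgDiag N ⋙ G)
    (isColimitOfPreserves G h) x
  exact ⟨F.1, F.2, y, hy⟩

lemma exists_fg_zero (A : ModuleCat.{u} R) [Module.Finite R A] (g : A ⟶ N) (y : G.obj A)
    (hy : G.map g y = 0) : ∃ F : Submodule R N, F.FG ∧
    ∃ h : A ⟶ ModuleCat.of R F, h ≫ ModuleCat.ofHom F.subtype = g ∧ G.map h y = 0 := by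
  obtain ⟨hc⟩ := fgCocone_isColimit N
  let F₀ : {F : Submodule R N // F.FG} := ⟨LinearMap.range g.hom, by
    rw [LinearMap.range_eq_map]; exact Module.Finite.fg_top.map g.hom⟩
  let g₀ : A ⟶ (fgDiag N).obj F₀ := ModuleCat.ofHom g.hom.rangeRestrict
  have h0 : g₀ ≫ (fgCocone N).ι.app F₀ = g := rfl
  have h1 : (G.mapCocone (fgCocone N)).ι.app F₀ (G.map g₀ y)
      = (G.mapCocone (fgCocone N)).ι.app F₀ 0 := by
    rw [map_zero]
    refine Eq.trans ?_ hy
    exact (congrArg (fun φ => φ.hom y) (G.map_comp g₀ ((fgCocone N).ι.app F₀))).symm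
  obtain ⟨F, a, b, hab⟩ := Concrete.isColimit_exists_of_rep_eq (fgDiag N ⋙ G)
    (isColimitOfPreserves G hc) _ _ h1
  refine ⟨F.1, F.2, g₀ ≫ (fgDiag N).map a, rfl, ?_⟩
  rw [map_zero] at hab
  refine (congrArg (fun φ => φ.hom y) (G.map_comp g₀ ((fgDiag N).map a))).trans ?_
  exact hab

end colim

lemma nak {R : Type u} [CommRing R] (q : Ideal R) [q.IsPrime] (M : Type u) [AddCommGroup M]
    [Module R M] [Module.Finite R M] (x : R) (hx : x ∈ q)
    (h : ∀ y : M, ∃ s, s ∉ q ∧ ∃ w : M, s • y = x • w) (y : M) : ∃ s, s ∉ q ∧ s • y = 0 := by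
  let A := Localization.AtPrime q
  let L := LocalizedModule q.primeCompl M
  have : Module.Finite A L := inferInstance
  have hbot : (⊤ : Submodule A L) = ⊥ := by
    refine Submodule.eq_bot_of_le_smul_of_le_jacobson_bot (IsLocalRing.maximalIdeal A) _
      Module.Finite.fg_top ?_ (IsLocalRing.maximalIdeal_le_jacobson _)
    rintro z -
    induction z using LocalizedModule.induction_on with
    | h m t =>
      obtain ⟨s, hs, w, hw⟩ := h m
      have hxm : algebraMap R A x ∈ IsLocalRing.maximalIdeal A := by
        rw [← Localization.AtPrime.map_eq_maximalIdeal]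
        exact Ideal.mem_map_of_mem _ hx
      have : LocalizedModule.mk m t =
          algebraMap R A x • LocalizedModule.mk w (t * ⟨s, hs⟩) := by
        rw [algebraMap_smul, LocalizedModule.smul'_mk, ← hw]
        rw [LocalizedModule.mk_eq]
        refine ⟨1, ?_⟩
        simp only [one_smul, Submonoid.smul_def, Submonoid.coe_mul, smul_smul]
      rw [this]
      exact Submodule.smul_mem_smul hxm trivial
  have : LocalizedModule.mkLinearMap q.primeCompl M y = 0 := by
    have : LocalizedModule.mkLinearMap q.primeCompl M y ∈ (⊤ : Submodule A L) := trivial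
    rw [hbot] at this
    exact this
  exact LocalizedModule.mem_ker_mkLinearMap_iff.mp this

lemma fg_denom {R : Type u} [CommRing R] (q : Ideal R) [q.IsPrime]
    (F : Submodule R q.ResidueField) (hF : F.FG) :
    ∃ s, s ∉ q ∧ ∀ z ∈ F, s • z ∈ LinearMap.range (Algebra.linearMap R q.ResidueField) := by
  induction F, hF using Submodule.fg_induction with
  | singleton z =>
    obtain ⟨a, rfl⟩ := IsLocalRing.residue_surjective z
    obtain ⟨⟨r, s⟩, h⟩ := IsLocalization.surj q.primeCompl a
    refine ⟨s, s.2, fun z hz => ?_⟩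
    obtain ⟨c, rfl⟩ := Submodule.mem_span_singleton.mp hz
    rw [smul_comm]
    refine Submodule.smul_mem _ _ ⟨r, ?_⟩
    have := congrArg (IsLocalRing.residue (Localization.AtPrime q)) h
    rw [map_mul] at this
    rw [Algebra.smul_def, mul_comm]
    exact this.symm
  | sup F₁ F₂ hF₁ hF₂ h₁ h₂ =>
    obtain ⟨s, hs, h₁⟩ := h₁
    obtain ⟨t, ht, h₂⟩ := h₂
    refine ⟨s * t, q.primeCompl.mul_mem hs ht, fun z hz => ?_⟩
    obtain ⟨a, ha, b, hb, rfl⟩ := Submodule.mem_sup.mp hz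
    rw [smul_add]
    refine add_mem ?_ ?_
    · rw [mul_comm, mul_smul]; exact Submodule.smul_mem _ _ (h₁ a ha)
    · rw [mul_smul]; exact Submodule.smul_mem _ _ (h₂ b hb)

lemma base {R : Type u} [CommRing R]
    (G : ModuleCat.{u} R ⥤ ModuleCat.{u} R) [G.Additive] [G.Linear R]
    [PreservesFilteredColimits G] (q : Ideal R) [q.IsPrime]
    (H : ∀ x : G.obj (residueFieldAt q), x = 0) :
    LocKill G q (ModuleCat.of R (R ⧸ q)) := by
  intro y
  let f : (R ⧸ q) →ₗ[R] q.ResidueField := Submodule.liftQ q (Algebra.linearMap R q.ResidueField)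
    (fun x hx => Ideal.algebraMap_residueField_eq_zero.mpr hx)
  have hf : Function.Injective f := by
    rw [← LinearMap.ker_eq_bot]
    apply Submodule.ker_liftQ_eq_bot
    intro x hx
    exact Ideal.algebraMap_residueField_eq_zero.mp hx
  have hrange : LinearMap.range f = LinearMap.range (Algebra.linearMap R q.ResidueField) :=
    Submodule.range_liftQ _ _ _
  let g : ModuleCat.of R (R ⧸ q) ⟶ residueFieldAt q := ModuleCat.ofHom f
  obtain ⟨F, hF, h, hh, h0⟩ := exists_fg_zero _ G _ g y (H _)
  obtain ⟨s, hs, hsF⟩ := fg_denom q F hF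
  let e := LinearEquiv.ofInjective f hf
  let k : F →ₗ[R] (R ⧸ q) := e.symm.toLinearMap ∘ₗ
    LinearMap.codRestrict (LinearMap.range f) (s • F.subtype) (fun z => by
      rw [hrange]; exact hsF z z.2)
  have hk : ∀ z, f (k z) = s • (z : q.ResidueField) := fun z => by
    have := LinearEquiv.ofInjective_apply (h := hf) f (k z)
    rw [← this]
    simp [k, e]
  refine ⟨s, hs, ?_⟩
  have hcomp : h ≫ ModuleCat.ofHom k = s • 𝟙 _ := by
    ext1
    apply LinearMap.ext
    intro z
    apply hf
    have h2 := congrArg (fun φ => φ.hom z) hh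
    refine (hk _).trans ?_
    refine (congrArg (s • ·) h2).trans ?_
    exact (f.map_smul s z).symm
  have h3 := map_smul_id_apply G s (𝟙 _) y
  rw [← hcomp, G.map_comp, G.map_id] at h3
  refine h3.symm.trans ?_
  refine (congrArg (G.map (ModuleCat.ofHom k)) h0).trans ?_
  exact map_zero _

lemma LocKill.of_exact {R : Type u} [CommRing R]
    {G : ModuleCat.{u} R ⥤ ModuleCat.{u} R} {q : Ideal R} [q.IsPrime]
    {A B C : ModuleCat.{u} R} (f : A ⟶ B) (g : B ⟶ C)
    (h : Function.Exact (G.map f) (G.map g)) (hA : LocKill G q A) (hC : LocKill G q C) :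
    LocKill G q B := by
  intro y
  obtain ⟨s, hs, h1⟩ := hC (G.map g y)
  obtain ⟨w, hw⟩ := (h (s • y)).mp (by rw [map_smul, h1])
  obtain ⟨t, ht, h2⟩ := hA w
  refine ⟨t * s, q.primeCompl.mul_mem ht hs, ?_⟩
  rw [mul_smul, ← hw, ← map_smul, h2, map_zero]

lemma LocKill.of_iso {R : Type u} [CommRing R]
    {G : ModuleCat.{u} R ⥤ ModuleCat.{u} R} {q : Ideal R}
    {A B : ModuleCat.{u} R} (e : A ≅ B) (hA : LocKill G q A) : LocKill G q B := by
  intro y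
  obtain ⟨s, hs, h1⟩ := hA (G.map e.inv y)
  refine ⟨s, hs, ?_⟩
  have h2 : G.map e.hom (G.map e.inv y) = y := by
    rw [← ConcreteCategory.comp_apply, ← G.map_comp]; simp
  rw [← h2, ← map_smul, h1, map_zero]

/-- modules killed by some element outside `q` -/
lemma LocKill.of_smul {R : Type u} [CommRing R]
    (G : ModuleCat.{u} R ⥤ ModuleCat.{u} R) [G.Additive] [G.Linear R] {q : Ideal R}
    {A : ModuleCat.{u} R} (s : R) (hs : s ∉ q) (h : ∀ a : A, s • a = 0) : LocKill G q A := by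
  intro y
  refine ⟨s, hs, ?_⟩
  have h3 := map_smul_id_apply G s (𝟙 A) y
  have : s • 𝟙 A = 0 := by
    ext a; exact h a
  rw [this, G.map_id, G.map_zero] at h3
  exact h3.symm

lemma main_step {R : Type u} [CommRing R] [IsNoetherianRing R]
    (G : ModuleCat.{u} R ⥤ ModuleCat.{u} R) [G.Additive] [G.Linear R]
    [PreservesFilteredColimits G]
    (hbdd : ∀ M : ModuleCat.{u} R, Module.Finite R M → Module.Finite R (G.obj M))
    (hhe : ∀ (M' M M'' : ModuleCat.{u} R) (f' : M' ⟶ M) (f : M ⟶ M''),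
      Function.Injective f' → Function.Surjective f → Function.Exact f' f →
        Function.Exact (G.map f') (G.map f))
    (q : Ideal R) [hq : q.IsPrime] (H : ∀ x : G.obj (residueFieldAt q), x = 0) (I : Ideal R) :
    ∀ (M : Type u) [AddCommGroup M] [Module R M], Module.Finite R M →
      I ≤ Module.annihilator R M → LocKill G q (ModuleCat.of R M) := by
  induction I using IsNoetherian.induction with
  | hgt I ih =>
  intro M _ _ hM
  induction hM using IsNoetherianRing.induction_on_isQuotientEquivQuotientPrime R with
  | subsingleton N =>
    intro _
    exact LocKill.of_smul G 1 (fun h => hq.ne_top ((Ideal.eq_top_iff_one _).mpr h))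
      (fun a => Subsingleton.elim (α := N) _ _)
  | exact N₁ N₂ N₃ f g hf hg hfg h₁ h₃ =>
    intro hI
    refine LocKill.of_exact (ModuleCat.ofHom f) (ModuleCat.ofHom g)
      (hhe _ _ _ _ _ hf hg hfg) (h₁ (hI.trans ?_)) (h₃ (hI.trans ?_))
    · exact f.annihilator_le_of_injective hf
    · exact g.annihilator_le_of_surjective hg
  | quotient N p e =>
    intro hI
    rw [e.annihilator_eq, Ideal.annihilator_quotient] at hI
    refine LocKill.of_iso (e.symm.toModuleIso) ?_
    rcases hI.lt_or_eq with hlt | heq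
    · exact ih p.1 hlt (R ⧸ p.1) inferInstance (by rw [Ideal.annihilator_quotient])
    · by_cases hpq : p.1 ≤ q
      · by_cases hqp : q ≤ p.1
        · have : p.1 = q := le_antisymm hpq hqp
          rw [this]
          exact base G q H
        · obtain ⟨x, hxq, hxp⟩ := SetLike.not_le_iff_exists.mp hqp
          have hJ : p.1 < p.1 ⊔ Ideal.span {x} := by
            refine lt_of_le_of_ne le_sup_left (fun h => hxp ?_)
            rw [h]
            exact (le_sup_right : _ ≤ p.1 ⊔ Ideal.span {x}) (Ideal.mem_span_singleton_self x)
          set J := p.1 ⊔ Ideal.span {x} with hJdef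
          have hC : LocKill G q (ModuleCat.of R (R ⧸ J)) :=
            ih J (by rw [heq]; exact hJ) (R ⧸ J) inferInstance
              (by rw [Ideal.annihilator_quotient])
          let A := ModuleCat.of R (R ⧸ p.1)
          let g : (R ⧸ p.1) →ₗ[R] (R ⧸ J) := Submodule.factor hJ.le
          have hex := hhe A A (ModuleCat.of R (R ⧸ J)) (x • 𝟙 A) (ModuleCat.ofHom g) ?_ ?_ ?_
          · have : Module.Finite R (G.obj A) := hbdd A (inferInstanceAs (Module.Finite R (R ⧸ p.1)))
            refine nak q (G.obj A) x hxq (fun y => ?_)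
            obtain ⟨s, hs, h1⟩ := hC (G.map (ModuleCat.ofHom g) y)
            obtain ⟨w, hw⟩ := (hex (s • y)).mp (by rw [map_smul, h1])
            refine ⟨s, hs, w, ?_⟩
            rw [← hw, map_smul_id_apply, G.map_id]
            rfl
          · have : Function.Injective (fun a : R ⧸ p.1 => x • a) := by
              have := p.2
              intro a b hab
              simp only [Algebra.smul_def] at hab
              refine mul_left_cancel₀ ?_ hab
              exact fun h => hxp (Ideal.Quotient.eq_zero_iff_mem.mp h)
            exact this
          · exact Submodule.factor_surjective hJ.le
          · have : Function.Exact (fun a : R ⧸ p.1 => x • a) g := by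
              intro a
              obtain ⟨r, rfl⟩ := Ideal.Quotient.mk_surjective a
              constructor
              · intro h
                have h : r ∈ J := Ideal.Quotient.eq_zero_iff_mem.mp h
                obtain ⟨b, hb, c, hc, rfl⟩ := Submodule.mem_sup.mp h
                obtain ⟨d, rfl⟩ := Ideal.mem_span_singleton'.mp hc
                refine ⟨Ideal.Quotient.mk _ d, ?_⟩
                rw [map_add, Ideal.Quotient.eq_zero_iff_mem.mpr hb, zero_add, mul_comm, map_mul]
                rfl
              · rintro ⟨b, hb⟩
                obtain ⟨d, rfl⟩ := Ideal.Quotient.mk_surjective b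
                rw [← hb]
                refine (map_smul g x _).trans ?_
                refine (Ideal.Quotient.eq_zero_iff_mem (I := J) (a := x * d)).mpr ?_
                exact Ideal.mul_mem_right _ _
                  ((le_sup_right : _ ≤ p.1 ⊔ Ideal.span {x}) (Ideal.mem_span_singleton_self x))
            exact this
      · obtain ⟨s, hsp, hsq⟩ := SetLike.not_le_iff_exists.mp hpq
        refine LocKill.of_smul G s hsq ?_
        intro a
        obtain ⟨r, rfl⟩ := Ideal.Quotient.mk_surjective a
        exact (Ideal.Quotient.eq_zero_iff_mem (I := p.1) (a := s * r)).mpr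
          (Ideal.mul_mem_right _ _ hsp)

/-- Let `R` be a commutative noetherian ring and `G : Mod_R → Mod_R` an `R`-linear functor
which is bounded, half-exact, and preserves filtered colimits.  Then for every prime
ideal `q` of `R`: `G(κ(q)) = 0` if and only if `G(N) = 0` for every `R`-module `N`
admitting an `R_q`-module structure (i.e. on which every element of `R ∖ q` acts
invertibly); in other words, `V(G) = { q ∈ Spec R : G(κ(q)) = 0 }`. -/
theorem stmt17 (R : Type u) [CommRing R] [IsNoetherianRing R]
    (G : ModuleCat.{u} R ⥤ ModuleCat.{u} R) [G.Additive] [G.Linear R]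
    [PreservesFilteredColimits G]
    (hbdd : ∀ M : ModuleCat.{u} R, Module.Finite R M → Module.Finite R (G.obj M))
    (hhe : ∀ (M' M M'' : ModuleCat.{u} R) (f' : M' ⟶ M) (f : M ⟶ M''),
      Function.Injective f' → Function.Surjective f → Function.Exact f' f →
        Function.Exact (G.map f') (G.map f))
    (q : Ideal R) [q.IsPrime] :
    (∀ x : G.obj (residueFieldAt q), x = 0) ↔
      (∀ N : ModuleCat.{u} R,
        (∀ a ∉ q, Function.Bijective (fun n : N => a • n)) →
        ∀ x : G.obj N, x = 0) := by
  constructor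
  · intro H N hN x
    obtain ⟨F, hF, y, rfl⟩ := exists_fg_rep N G x
    obtain ⟨s, hs, hy⟩ := main_step G hbdd hhe q H ⊥ F (Module.Finite.of_fg hF) bot_le y
    set x := G.map (ModuleCat.ofHom F.subtype) y with hx
    have hsx : s • x = 0 := by rw [hx, ← map_smul, hy, map_zero]
    let e : N ≃ₗ[R] N := LinearEquiv.ofBijective (s • LinearMap.id) (hN s hs)
    have he : e.toModuleIso.hom = s • 𝟙 N := rfl
    have h1 : G.map e.toModuleIso.hom x = 0 := by
      rw [he, map_smul_id_apply, G.map_id]; exact hsx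
    have h2 : G.map e.toModuleIso.inv (G.map e.toModuleIso.hom x) = x := by
      rw [← ConcreteCategory.comp_apply, ← G.map_comp, Iso.hom_inv_id, G.map_id]; rfl
    rw [← h2, h1, map_zero]
  · intro H
    refine H _ (fun a ha => ?_)
    have h0 : algebraMap R q.ResidueField a ≠ 0 :=
      fun h => ha (Ideal.algebraMap_residueField_eq_zero.mp h)
    have : Function.Bijective (fun n : q.ResidueField => a • n) := by
      simp only [Algebra.smul_def]
      exact mulLeft_bijective₀ _ h0
    exact this
end
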